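/- Let (X,A) and (Y,B) be compact metric pairs, regarded as hypernetworks (X × A, X × A, ω_X) and (Y × B, Y × B, ω_Y) with ω_X((x,a),(x',a')) = (d_X(x,x') + d_X(a,a'))/2 and ω_Y((y,b),(y',b')) = (d_Y(y,y') + d_Y(b,b'))/2. For any pair correspondence R between (X,A) and (Y,B), regarded as a correspondence between X × A and Y × B, the network distortion dis_net(R) := sup{|ω_X((x,a),(x',a')) − ω_Y((y,b),(y',b'))| : (x,a,y,b),(x',a',y',b') ∈ R} satisfies dis_net(R) ≤ dis(R). Consequently the network Gromov–Hausdorff distance satisfies d_NET(X × A, Y × B) ≤ d_GH((X,A),(Y,B)). -/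

import Mathlib

open Metric Set

/-- An admissible metric on the disjoint union of two metric spaces: a metric on `X ⊕ Y`
restricting to the given metrics on `X` and on `Y`. -/
structure AdmissibleMetric (X Y : Type*) [MetricSpace X] [MetricSpace Y] where
  d : (X ⊕ Y) → (X ⊕ Y) → ℝ
  refl : ∀ p, d p p = 0
  pos : ∀ p q, p ≠ q → 0 < d p q
  symm : ∀ p q, d p q = d q p
  triangle : ∀ p q r, d p r ≤ d p q + d q r
  restr_left : ∀ x x' : X, d (.inl x) (.inl x') = dist x x'
  restr_right : ∀ y y' : Y, d (.inr y) (.inr y') = dist y y'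

/-- Hausdorff distance between two subsets with respect to an abstract distance function. -/
noncomputable def hausdorffDistWrt {Z : Type*} (d : Z → Z → ℝ) (S T : Set Z) : ℝ :=
  max (⨆ s : S, ⨅ t : T, d s t) (⨆ t : T, ⨅ s : S, d s t)

/-- Hausdorff distance between the pairs `(X, A)` and `(Y, B)` inside `X ⊕ Y`,
with respect to a distance function on `X ⊕ Y`:
`d_H^δ((X,A),(Y,B)) = d_H^δ(X,Y) + d_H^δ(A,B)`. -/
noncomputable def pairHausdorffDistWrt {X Y : Type*} [MetricSpace X] [MetricSpace Y]
    (d : (X ⊕ Y) → (X ⊕ Y) → ℝ) (A : Set X) (B : Set Y) : ℝ :=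
  hausdorffDistWrt d (Set.range Sum.inl) (Set.range Sum.inr)
    + hausdorffDistWrt d (Sum.inl '' A) (Sum.inr '' B)

/-- Hausdorff distance between pairs with respect to an admissible metric. -/
noncomputable def pairHausdorffDist {X Y : Type*} [MetricSpace X] [MetricSpace Y]
    (δ : AdmissibleMetric X Y) (A : Set X) (B : Set Y) : ℝ :=
  pairHausdorffDistWrt δ.d A B

/-- The Gromov–Hausdorff distance between the metric pairs `(X, A)` and `(Y, B)`:
the infimum of the pair Hausdorff distances over all admissible metrics on `X ⊕ Y`. -/
noncomputable def pairGHDist {X Y : Type*} [MetricSpace X] [MetricSpace Y]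
    (A : Set X) (B : Set Y) : ℝ :=
  sInf {r | ∃ δ : AdmissibleMetric X Y, r = pairHausdorffDist δ A B}

/-- A pair correspondence between `(X, A)` and `(Y, B)`: a correspondence between `X` and `Y`
whose restriction to `A × B` is a correspondence between `A` and `B`. -/
structure IsPairCorrespondence {X Y : Type*} (R : Set (X × Y)) (A : Set X) (B : Set Y) : Prop where
  ex_right : ∀ x : X, ∃ y : Y, (x, y) ∈ R
  ex_left : ∀ y : Y, ∃ x : X, (x, y) ∈ R
  ex_right_pair : ∀ a ∈ A, ∃ b ∈ B, (a, b) ∈ R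
  ex_left_pair : ∀ b ∈ B, ∃ a ∈ A, (a, b) ∈ R

/-- The distortion of a pair correspondence:
`dis(R) = ½ (sup_{(x,y),(x',y') ∈ R} |d_X(x,x') − d_Y(y,y')|
          + sup_{(a,b),(a',b') ∈ R ∩ A×B} |d_X(a,a') − d_Y(b,b')|)`. -/
noncomputable def pairDistortion {X Y : Type*} [MetricSpace X] [MetricSpace Y]
    (R : Set (X × Y)) (A : Set X) (B : Set Y) : ℝ :=
  (1 / 2) * ((⨆ p : R, ⨆ q : R, |dist (p : X × Y).1 (q : X × Y).1 - dist (p : X × Y).2 (q : X × Y).2|)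
    + (⨆ p : ↥(R ∩ A ×ˢ B), ⨆ q : ↥(R ∩ A ×ˢ B),
        |dist (p : X × Y).1 (q : X × Y).1 - dist (p : X × Y).2 (q : X × Y).2|))

/-- A correspondence between two sets: a relation with both projections surjective. -/
def IsCorrespondence {α β : Type*} (C : Set (α × β)) : Prop :=
  (∀ a : α, ∃ b : β, (a, b) ∈ C) ∧ (∀ b : β, ∃ a : α, (a, b) ∈ C)

/-- The network distortion of a correspondence between two (hyper)networks `(α, α, ω)` and
`(β, β, ω')`. -/
noncomputable def netDistortion {α β : Type*} (ω : α → α → ℝ) (ω' : β → β → ℝ)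
    (C : Set (α × β)) : ℝ :=
  ⨆ p : C, ⨆ q : C, |ω (p : α × β).1 (q : α × β).1 - ω' (p : α × β).2 (q : α × β).2|

/-- The network Gromov–Hausdorff distance between the (hyper)networks `(α, α, ω)` and
`(β, β, ω')`: half the infimum of the network distortion over all correspondences. -/
noncomputable def netDist {α β : Type*} (ω : α → α → ℝ) (ω' : β → β → ℝ) : ℝ :=
  (1 / 2) * sInf {d : ℝ | ∃ C : Set (α × β), IsCorrespondence C ∧ d = netDistortion ω ω' C}

/-- The weight function of the hypernetwork `(X × A, X × A, ω_X)` associated with the metric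
pair `(X, A)`: `ω_X((x,a),(x',a')) = (d_X(x,x') + d_X(a,a'))/2`. -/
noncomputable def pairWeight (X : Type*) [MetricSpace X] (A : Set X) :
    X × ↥A → X × ↥A → ℝ :=
  fun p q => (dist p.1 q.1 + dist (p.2 : X) (q.2 : X)) / 2

/-- The correspondence between `X × A` and `Y × B` induced by a pair correspondence
`R ⊆ X × Y` between `(X,A)` and `(Y,B)`. -/
def inducedNetCorrespondence {X Y : Type*} (R : Set (X × Y)) (A : Set X) (B : Set Y) :
    Set ((X × ↥A) × (Y × ↥B)) :=
  {p | (p.1.1, p.2.1) ∈ R ∧ ((p.1.2 : X), (p.2.2 : Y)) ∈ R}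

theorem le_iSup_iSup_of_forall_le {ι κ : Type*} {f : ι → κ → ℝ} {M : ℝ} (hM : ∀ i j, f i j ≤ M)
    (h0 : 0 ≤ M) (i : ι) (j : κ) : f i j ≤ ⨆ i, ⨆ j, f i j :=
  (le_ciSup (f := fun j => f i j) ⟨M, by rintro _ ⟨j, rfl⟩; exact hM i j⟩ j).trans
    (le_ciSup (f := fun i => ⨆ j, f i j)
      ⟨M, by rintro _ ⟨i, rfl⟩; exact Real.iSup_le (hM i) h0⟩ i)

theorem abs_dist_sub_dist_le_diam_add_diam {X Y : Type*} [MetricSpace X] [MetricSpace Y]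
    [CompactSpace X] [CompactSpace Y] (x x' : X) (y y' : Y) :
    |dist x x' - dist y y'| ≤ diam (univ : Set X) + diam (univ : Set Y) := by
  have hx := dist_le_diam_of_mem (isCompact_univ (X := X)).isBounded (mem_univ x) (mem_univ x')
  have hy := dist_le_diam_of_mem (isCompact_univ (X := Y)).isBounded (mem_univ y) (mem_univ y')
  have hx0 := dist_nonneg (x := x) (y := x')
  have hy0 := dist_nonneg (x := y) (y := y')
  rw [abs_le]
  constructor <;> linarith

theorem abs_pairWeight_sub_pairWeight_le {X Y : Type*} [MetricSpace X] [MetricSpace Y]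
    {A : Set X} {B : Set Y} (p p' : X × A) (q q' : Y × B) :
    |pairWeight X A p p' - pairWeight Y B q q'| ≤
      (1 / 2) * (|dist p.1 p'.1 - dist q.1 q'.1| +
        |dist (p.2 : X) (p'.2 : X) - dist (q.2 : Y) (q'.2 : Y)|) := by
  have h := abs_add_le (dist p.1 p'.1 - dist q.1 q'.1)
    (dist (p.2 : X) (p'.2 : X) - dist (q.2 : Y) (q'.2 : Y))
  have e : pairWeight X A p p' - pairWeight Y B q q' =
      (1 / 2) * ((dist p.1 p'.1 - dist q.1 q'.1) +
        (dist (p.2 : X) (p'.2 : X) - dist (q.2 : Y) (q'.2 : Y))) := by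
    simp only [pairWeight]; ring
  rw [e, abs_mul, abs_of_pos (by norm_num : (0 : ℝ) < 1 / 2)]
  linarith

theorem netDistortion_nonneg {α β : Type*} (ω : α → α → ℝ) (ω' : β → β → ℝ)
    (C : Set (α × β)) : 0 ≤ netDistortion ω ω' C :=
  Real.iSup_nonneg fun _ => Real.iSup_nonneg fun _ => abs_nonneg _

theorem netDistortion_le {α β : Type*} {ω : α → α → ℝ} {ω' : β → β → ℝ} {C : Set (α × β)} {M : ℝ}
    (hM : 0 ≤ M) (h : ∀ p ∈ C, ∀ q ∈ C, |ω p.1 q.1 - ω' p.2 q.2| ≤ M) :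
    netDistortion ω ω' C ≤ M :=
  Real.iSup_le (fun p => Real.iSup_le (fun q => h p p.2 q q.2) hM) hM

theorem netDist_le_of_isCorrespondence {α β : Type*} {ω : α → α → ℝ} {ω' : β → β → ℝ}
    {C : Set (α × β)} (hC : IsCorrespondence C) :
    netDist ω ω' ≤ (1 / 2) * netDistortion ω ω' C := by
  refine mul_le_mul_of_nonneg_left (csInf_le ⟨0, ?_⟩ ⟨C, hC, rfl⟩) (by norm_num)
  rintro _ ⟨C', -, rfl⟩
  exact netDistortion_nonneg _ _ _

theorem netDistortion_inducedNetCorrespondence_le {X Y : Type*} [MetricSpace X] [MetricSpace Y]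
    [CompactSpace X] [CompactSpace Y] (R : Set (X × Y)) (A : Set X) (B : Set Y) :
    netDistortion (pairWeight X A) (pairWeight Y B) (inducedNetCorrespondence R A B)
      ≤ pairDistortion R A B := by
  have hdiam : 0 ≤ diam (univ : Set X) + diam (univ : Set Y) := add_nonneg diam_nonneg diam_nonneg
  refine netDistortion_le ?_ fun p hp q hq => (abs_pairWeight_sub_pairWeight_le _ _ _ _).trans ?_
  · exact mul_nonneg (by norm_num) (add_nonneg
      (Real.iSup_nonneg fun _ => Real.iSup_nonneg fun _ => abs_nonneg _)
      (Real.iSup_nonneg fun _ => Real.iSup_nonneg fun _ => abs_nonneg _))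
  · refine mul_le_mul_of_nonneg_left (add_le_add ?_ ?_) (by norm_num)
    · exact le_iSup_iSup_of_forall_le
        (f := fun p q : R => |dist (p : X × Y).1 (q : X × Y).1 - dist (p : X × Y).2 (q : X × Y).2|)
        (fun _ _ => abs_dist_sub_dist_le_diam_add_diam _ _ _ _) hdiam
        ⟨(p.1.1, p.2.1), hp.1⟩ ⟨(q.1.1, q.2.1), hq.1⟩
    · exact le_iSup_iSup_of_forall_le
        (f := fun p q : ↥(R ∩ A ×ˢ B) =>
          |dist (p : X × Y).1 (q : X × Y).1 - dist (p : X × Y).2 (q : X × Y).2|)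
        (fun _ _ => abs_dist_sub_dist_le_diam_add_diam _ _ _ _) hdiam
        ⟨(p.1.2, p.2.2), hp.2, p.1.2.2, p.2.2.2⟩ ⟨(q.1.2, q.2.2), hq.2, q.1.2.2, q.2.2.2⟩

theorem hausdorffDistWrt_nonneg {Z : Type*} {d : Z → Z → ℝ} (h0 : ∀ p q, 0 ≤ d p q)
    (S T : Set Z) : 0 ≤ hausdorffDistWrt d S T :=
  le_max_of_le_left (Real.iSup_nonneg fun _ => Real.iInf_nonneg fun _ => h0 _ _)

theorem exists_lt_of_iSup_iInf_lt {ι κ : Type*} [Nonempty κ] {f : ι → κ → ℝ} {M r : ℝ}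
    (h0 : ∀ i j, 0 ≤ f i j) (hM : ∀ i j, f i j ≤ M) (hr : ⨆ i, ⨅ j, f i j < r) (i : ι) :
    ∃ j, f i j < r := by
  refine exists_lt_of_ciInf_lt (lt_of_le_of_lt (le_ciSup (f := fun i => ⨅ j, f i j) ⟨M, ?_⟩ i) hr)
  rintro _ ⟨i, rfl⟩
  obtain ⟨j⟩ := ‹Nonempty κ›
  exact (ciInf_le ⟨0, by rintro _ ⟨j, rfl⟩; exact h0 i j⟩ j).trans (hM i j)

theorem exists_lt_of_hausdorffDistWrt_lt_left {Z : Type*} {d : Z → Z → ℝ} {S T : Set Z} {M r : ℝ}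
    (h0 : ∀ p q, 0 ≤ d p q) (hM : ∀ p q, d p q ≤ M) (hT : T.Nonempty)
    (hr : hausdorffDistWrt d S T < r) {s : Z} (hs : s ∈ S) : ∃ t ∈ T, d s t < r := by
  have := hT.to_subtype
  obtain ⟨t, ht⟩ := exists_lt_of_iSup_iInf_lt (f := fun (s : S) (t : T) => d s t)
    (fun _ _ => h0 _ _) (fun _ _ => hM _ _) ((le_max_left _ _).trans_lt hr) ⟨s, hs⟩
  exact ⟨t, t.2, ht⟩

theorem exists_lt_of_hausdorffDistWrt_lt_right {Z : Type*} {d : Z → Z → ℝ} {S T : Set Z} {M r : ℝ}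
    (h0 : ∀ p q, 0 ≤ d p q) (hM : ∀ p q, d p q ≤ M) (hS : S.Nonempty)
    (hr : hausdorffDistWrt d S T < r) {t : Z} (ht : t ∈ T) : ∃ s ∈ S, d s t < r := by
  have := hS.to_subtype
  obtain ⟨s, hs⟩ := exists_lt_of_iSup_iInf_lt (f := fun (t : T) (s : S) => d s t)
    (fun _ _ => h0 _ _) (fun _ _ => hM _ _) ((le_max_right _ _).trans_lt hr) ⟨t, ht⟩
  exact ⟨s, s.2, hs⟩

namespace AdmissibleMetric

variable {X Y : Type*} [MetricSpace X] [MetricSpace Y]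

theorem nonneg (δ : AdmissibleMetric X Y) (p q : X ⊕ Y) : 0 ≤ δ.d p q := by
  by_cases h : p = q
  · rw [h, δ.refl]
  · exact (δ.pos p q h).le

theorem exists_forall_le [CompactSpace X] [CompactSpace Y] [Nonempty X] [Nonempty Y]
    (δ : AdmissibleMetric X Y) : ∃ M, ∀ p q, δ.d p q ≤ M := by
  obtain ⟨x₀⟩ := ‹Nonempty X›
  obtain ⟨y₀⟩ := ‹Nonempty Y›
  have hX (x : X) : dist x x₀ ≤ diam (univ : Set X) :=
    dist_le_diam_of_mem isCompact_univ.isBounded (mem_univ _) (mem_univ _)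
  have hY (y : Y) : dist y y₀ ≤ diam (univ : Set Y) :=
    dist_le_diam_of_mem isCompact_univ.isBounded (mem_univ _) (mem_univ _)
  have key (p : X ⊕ Y) : δ.d p (.inl x₀) ≤
      diam (univ : Set X) + diam (univ : Set Y) + δ.d (.inr y₀) (.inl x₀) := by
    have h₁ : 0 ≤ diam (univ : Set X) := diam_nonneg
    have h₂ : 0 ≤ diam (univ : Set Y) := diam_nonneg
    have h₃ := δ.nonneg (.inr y₀) (.inl x₀)
    rcases p with x | y
    · rw [δ.restr_left]
      linarith [hX x]
    · have h := δ.triangle (.inr y) (.inr y₀) (.inl x₀)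
      rw [δ.restr_right] at h
      linarith [hY y]
  refine ⟨2 * (diam (univ : Set X) + diam (univ : Set Y) + δ.d (.inr y₀) (.inl x₀)),
    fun p q => ?_⟩
  have h := δ.triangle p (.inl x₀) q
  rw [δ.symm (.inl x₀) q] at h
  linarith [key p, key q]

theorem abs_dist_sub_dist_le (δ : AdmissibleMetric X Y) (x x' : X) (y y' : Y) :
    |dist x x' - dist y y'| ≤ δ.d (.inl x) (.inr y) + δ.d (.inl x') (.inr y') := by
  rw [← δ.restr_left, ← δ.restr_right, abs_le]
  have h₁ := δ.triangle (.inl x) (.inr y) (.inl x')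
  have h₂ := δ.triangle (.inr y) (.inr y') (.inl x')
  have h₃ := δ.triangle (.inr y) (.inl x) (.inr y')
  have h₄ := δ.triangle (.inl x) (.inl x') (.inr y')
  rw [δ.symm (.inr y') (.inl x')] at h₂
  rw [δ.symm (.inr y) (.inl x)] at h₃
  constructor <;> linarith

instance [Nonempty X] [Nonempty Y] : Nonempty (AdmissibleMetric X Y) :=
  letI := metricSpaceSum (X := X) (Y := Y)
  ⟨{ d := dist
     refl := dist_self
     pos := fun _ _ h => dist_pos.2 h
     symm := dist_comm
     triangle := dist_triangle
     restr_left := fun _ _ => rfl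
     restr_right := fun _ _ => rfl }⟩

end AdmissibleMetric

theorem netDist_le_half_pairHausdorffDist {X Y : Type*} [MetricSpace X] [MetricSpace Y]
    [CompactSpace X] [CompactSpace Y] {A : Set X} {B : Set Y} (hA : A.Nonempty) (hB : B.Nonempty)
    (δ : AdmissibleMetric X Y) :
    netDist (pairWeight X A) (pairWeight Y B) ≤ (1 / 2) * pairHausdorffDist δ A B := by
  have : Nonempty X := hA.to_type
  have : Nonempty Y := hB.to_type
  obtain ⟨M, hM⟩ := δ.exists_forall_le
  refine le_of_forall_pos_le_add fun ε hε => ?_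
  unfold pairHausdorffDist pairHausdorffDistWrt
  have hr₀ := hausdorffDistWrt_nonneg δ.nonneg (range Sum.inl) (range Sum.inr)
  have hs₀ := hausdorffDistWrt_nonneg δ.nonneg (Sum.inl '' A) (Sum.inr '' B)
  set r := hausdorffDistWrt δ.d (range Sum.inl) (range Sum.inr) with hr
  set s := hausdorffDistWrt δ.d (Sum.inl '' A) (Sum.inr '' B) with hs
  have hr' : r < r + ε := lt_add_of_pos_right _ hε
  have hs' : s < s + ε := lt_add_of_pos_right _ hε
  let C : Set ((X × A) × (Y × B)) := {p | δ.d (.inl p.1.1) (.inr p.2.1) < r + ε ∧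
    δ.d (.inl p.1.2) (.inr p.2.2) < s + ε}
  have hC : IsCorrespondence C := by
    constructor
    · rintro ⟨x, a⟩
      obtain ⟨_, ⟨y, rfl⟩, hy⟩ := exists_lt_of_hausdorffDistWrt_lt_left δ.nonneg hM
        (range_nonempty _) hr' (mem_range_self x)
      obtain ⟨_, ⟨b, hb, rfl⟩, hab⟩ := exists_lt_of_hausdorffDistWrt_lt_left δ.nonneg hM
        (hB.image _) hs' (mem_image_of_mem _ a.2)
      exact ⟨(y, ⟨b, hb⟩), hy, hab⟩
    · rintro ⟨y, b⟩
      obtain ⟨_, ⟨x, rfl⟩, hx⟩ := exists_lt_of_hausdorffDistWrt_lt_right δ.nonneg hM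
        (range_nonempty _) hr' (mem_range_self y)
      obtain ⟨_, ⟨a, ha, rfl⟩, hab⟩ := exists_lt_of_hausdorffDistWrt_lt_right δ.nonneg hM
        (hA.image _) hs' (mem_image_of_mem _ b.2)
      exact ⟨(x, ⟨a, ha⟩), hx, hab⟩
  have hdis : netDistortion (pairWeight X A) (pairWeight Y B) C ≤ r + s + 2 * ε := by
    refine netDistortion_le (by positivity) fun p hp q hq =>
      (abs_pairWeight_sub_pairWeight_le _ _ _ _).trans ?_
    have h₁ := δ.abs_dist_sub_dist_le p.1.1 q.1.1 p.2.1 q.2.1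
    have h₂ := δ.abs_dist_sub_dist_le (p.1.2 : X) q.1.2 (p.2.2 : Y) q.2.2
    linarith [hp.1, hp.2, hq.1, hq.2]
  linarith [netDist_le_of_isCorrespondence (ω := pairWeight X A) (ω' := pairWeight Y B) hC]

theorem netDist_pairWeight_le_pairGHDist {X Y : Type*} [MetricSpace X] [MetricSpace Y]
    [CompactSpace X] [CompactSpace Y] {A : Set X} {B : Set Y} (hA : A.Nonempty)
    (hB : B.Nonempty) : netDist (pairWeight X A) (pairWeight Y B) ≤ pairGHDist A B := by
  have : Nonempty X := hA.to_type
  have : Nonempty Y := hB.to_type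
  obtain ⟨δ₀⟩ := (inferInstance : Nonempty (AdmissibleMetric X Y))
  refine le_csInf ⟨_, δ₀, rfl⟩ ?_
  rintro _ ⟨δ, rfl⟩
  have h₀ : 0 ≤ pairHausdorffDist δ A B :=
    add_nonneg (hausdorffDistWrt_nonneg δ.nonneg _ _) (hausdorffDistWrt_nonneg δ.nonneg _ _)
  linarith [netDist_le_half_pairHausdorffDist hA hB δ]

/-- For compact metric pairs `(X,A)`, `(Y,B)` regarded as hypernetworks
`(X × A, X × A, ω_X)` and `(Y × B, Y × B, ω_Y)`, and any pair correspondence `R` between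
`(X,A)` and `(Y,B)` regarded as a correspondence between `X × A` and `Y × B`, the network
distortion satisfies `dis_net(R) ≤ dis(R)`; consequently
`d_NET(X × A, Y × B) ≤ d_GH((X,A),(Y,B))`. -/
theorem netDistortion_le_pairDistortion_and_netDist_le_pairGHDist
    {X Y : Type*} [MetricSpace X] [MetricSpace Y] [CompactSpace X] [CompactSpace Y]
    (A : Set X) (B : Set Y) (hAne : A.Nonempty) (hAcl : IsClosed A)
    (hBne : B.Nonempty) (hBcl : IsClosed B)
    (R : Set (X × Y)) (hR : IsPairCorrespondence R A B) :
    netDistortion (pairWeight X A) (pairWeight Y B) (inducedNetCorrespondence R A B)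
      ≤ pairDistortion R A B ∧
    netDist (pairWeight X A) (pairWeight Y B) ≤ pairGHDist A B := by
  exact ⟨netDistortion_inducedNetCorrespondence_le R A B,
    netDist_pairWeight_le_pairGHDist hAne hBne⟩
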